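/- arXiv:1111.6020 — 2 statements merged into one kernel-verified Lean document; each statement's English description precedes it below -/
import Mathlib

section
/- The restricted Legendre–Ostrogradsky map FL is a local diffeomorphism at a point w = (t, q_0, …, q_{2k−1}) if and only if the Hessian matrix W(t, q_0, …, q_k) is invertible. Consequently, FL is a local diffeomorphism (at every point of ℝ × (ℝⁿ)^{2k}) if and only if L is regular, i.e. det W ≠ 0 everywhere. -/
open scoped ContDiff RealInnerProductSpace

noncomputable section

/-- `ℝⁿ` as a Euclidean space. -/
abbrev Evec (n : ℕ) := EuclideanSpace ℝ (Fin n)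

/-- The partial gradient `∂f/∂q_i` of a function `f : ℝ × (ℝⁿ)^N → ℝ`
with respect to the variable `q_i`. -/
noncomputable def pgradN {n N : ℕ} (f : ℝ × (Fin N → Evec n) → ℝ)
    (i : Fin N) (x : ℝ × (Fin N → Evec n)) : Evec n :=
  gradient (fun v => f (x.1, Function.update x.2 i v)) (x.2 i)

/-- The total time derivative `d_T f = ∂f/∂t + ∑_i q_{i+1} · ∂f/∂q_i` of a function
on `ℝ × (ℝⁿ)^N` (functions of `(t, q_0, …, q_m)` are regarded as functions on this
space, not depending on the higher variables, for which the extra terms vanish). -/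
noncomputable def dT {n N : ℕ} {F : Type*} [NormedAddCommGroup F] [NormedSpace ℝ F]
    (f : ℝ × (Fin N → Evec n) → F) : ℝ × (Fin N → Evec n) → F :=
  fun x => deriv (fun s => f (s, x.2)) x.1 +
    ∑ i : Fin N, if h : (i : ℕ) + 1 < N then
      fderiv ℝ (fun v => f (x.1, Function.update x.2 i v)) (x.2 i) (x.2 ⟨(i : ℕ)+1, h⟩)
    else 0

/-- A `k`-th order Lagrangian regarded as a function on `ℝ × (ℝⁿ)^N`, `k+1 ≤ N`. -/
def extendL {n k N : ℕ} (h : k + 1 ≤ N) (L : ℝ × (Fin (k+1) → Evec n) → ℝ) :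
    ℝ × (Fin N → Evec n) → ℝ :=
  fun x => L (x.1, fun i => x.2 ⟨(i : ℕ), by have := i.isLt; omega⟩)

/-- The Jacobi–Ostrogradsky momentum function
`p̂^{r-1} = ∑_{i=0}^{k-r} (-1)^i d_T^i (∂L/∂q_{r+i})`, as a function on `ℝ × (ℝⁿ)^N`. -/
noncomputable def hatP {n k N : ℕ} (h : k + 1 ≤ N) (L : ℝ × (Fin (k+1) → Evec n) → ℝ)
    (r : ℕ) (hr1 : 1 ≤ r) (hrk : r ≤ k) : ℝ × (Fin N → Evec n) → Evec n :=
  fun x => ∑ i : Fin (k - r + 1),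
    ((-1:ℝ)^(i : ℕ)) •
      (dT^[(i : ℕ)] (pgradN (extendL h L) ⟨r + (i : ℕ), by have := i.isLt; omega⟩)) x

/-- The Hessian matrix `W` of a `k`-th order Lagrangian with respect to the highest
velocity variable `q_k`: `W A B = ∂²L/∂q_k^B ∂q_k^A`. -/
noncomputable def hessQk {n k : ℕ} (L : ℝ × (Fin (k+1) → Evec n) → ℝ)
    (x : ℝ × (Fin (k+1) → Evec n)) : Matrix (Fin n) (Fin n) ℝ :=
  fun A B =>
    fderiv ℝ (fun v => gradient (fun w => L (x.1, Function.update x.2 (Fin.last k) w)) v A)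
      (x.2 (Fin.last k)) (EuclideanSpace.single B 1)

/-- The restricted Legendre–Ostrogradsky map
`FL(t, q_0, …, q_{2k-1}) = (t, q_0, …, q_{k-1}, p̂^0, …, p̂^{k-1})`. -/
noncomputable def legendreFL {n k : ℕ} (hk : 1 ≤ k) (L : ℝ × (Fin (k+1) → Evec n) → ℝ) :
    ℝ × (Fin (2*k) → Evec n) → ℝ × (Fin (2*k) → Evec n) :=
  fun x => (x.1, fun j => if h : (j : ℕ) < k then x.2 ⟨(j : ℕ), by omega⟩
    else hatP (by omega) L ((j : ℕ) - k + 1) (by omega)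
      (by have := j.isLt; omega) x)

/-- Truncation of a point of `ℝ × (ℝⁿ)^{2k}` to a point of `ℝ × (ℝⁿ)^{k+1}`. -/
def truncK {n k : ℕ} (hk : 1 ≤ k) (w : ℝ × (Fin (2*k) → Evec n)) :
    ℝ × (Fin (k+1) → Evec n) :=
  (w.1, fun i => w.2 ⟨(i : ℕ), by have := i.isLt; omega⟩)


/-- The inclusion of the `i`-th factor `ℝⁿ` into `ℝ × (ℝⁿ)^N`. -/
def inclQ (n N : ℕ) (i : Fin N) : Evec n →L[ℝ] ℝ × (Fin N → Evec n) :=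
  (ContinuousLinearMap.inr ℝ ℝ (Fin N → Evec n)).comp
    (ContinuousLinearMap.single ℝ (fun _ : Fin N => Evec n) i)

/-- The linear part `(t, q_0, …, q_{N-1}) ↦ (0, q_1, …, q_{N-1}, 0)` of the total time
derivative. -/
def shiftQ (n N : ℕ) : (ℝ × (Fin N → Evec n)) →L[ℝ] ℝ × (Fin N → Evec n) :=
  ∑ i : Fin N, if h : (i : ℕ) + 1 < N then
    (inclQ n N i).comp ((ContinuousLinearMap.proj (R := ℝ) (φ := fun _ : Fin N => Evec n)
      ⟨(i : ℕ) + 1, h⟩).comp (ContinuousLinearMap.snd ℝ ℝ (Fin N → Evec n)))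
  else 0

/-- The derivative of `f` vanishes in the directions `q_m, q_{m+1}, …`. -/
def IndepFrom {n N : ℕ} {F : Type*} [NormedAddCommGroup F] [NormedSpace ℝ F]
    (m : ℕ) (f : ℝ × (Fin N → Evec n) → F) : Prop :=
  ∀ x (j : Fin N), m ≤ (j : ℕ) → ∀ u, fderiv ℝ f x (inclQ n N j u) = 0

section TotalDerivative

variable {n N : ℕ} {F : Type*} [NormedAddCommGroup F] [NormedSpace ℝ F]

lemma inclQ_apply (i : Fin N) (u : Evec n) :
    inclQ n N i u = (0, Pi.single i u) := rfl

lemma eq_time_add_sum_inclQ (z : ℝ × (Fin N → Evec n)) :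
    z = (z.1, 0) + ∑ j, inclQ n N j (z.2 j) := by
  have h : ∑ j, inclQ n N j (z.2 j) = (0, z.2) := by
    simp only [inclQ, ContinuousLinearMap.comp_apply, ← map_sum]
    simp [Finset.univ_sum_single]
  rw [h]
  simp

lemma shiftQ_inclQ (i j : Fin N) (h : (i : ℕ) + 1 = j) (u : Evec n) :
    shiftQ n N (inclQ n N j u) = inclQ n N i u := by
  have hj := j.isLt
  rw [shiftQ, sum_apply, Finset.sum_eq_single i]
  · have hij : (⟨(i : ℕ) + 1, by omega⟩ : Fin N) = j := Fin.ext h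
    rw [dif_pos (by omega)]
    simp [hij, inclQ_apply]
  · intro b _ hb
    split_ifs with hlt
    · have hne : (⟨(b : ℕ) + 1, hlt⟩ : Fin N) ≠ j := by
        intro e
        apply hb
        apply Fin.ext
        have := congrArg Fin.val e
        simp at this
        omega
      simp [inclQ_apply, hne]
    · simp
  · simp

lemma hasFDerivAt_update_q (x : ℝ × (Fin N → Evec n)) (i : Fin N) (v : Evec n) :
    HasFDerivAt (fun v => (x.1, Function.update x.2 i v)) (inclQ n N i) v := by
  have h := (hasFDerivAt_const (𝕜 := ℝ) x.1 v).prodMk (hasFDerivAt_update (𝕜 := ℝ) x.2 (i := i) v)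
  refine h.congr_fderiv ?_
  ext u j
  · simp [inclQ_apply]
  · by_cases hj : j = i
    · subst hj; simp [inclQ_apply]
    · simp [inclQ_apply, hj]

lemma hasFDerivAt_comp_update_q {f : ℝ × (Fin N → Evec n) → F} (x : ℝ × (Fin N → Evec n))
    (hf : DifferentiableAt ℝ f x) (i : Fin N) :
    HasFDerivAt (fun v => f (x.1, Function.update x.2 i v))
      ((fderiv ℝ f x).comp (inclQ n N i)) (x.2 i) := by
  have hx : (x.1, Function.update x.2 i (x.2 i)) = x := by simp
  have h : HasFDerivAt f (fderiv ℝ f x) (x.1, Function.update x.2 i (x.2 i)) := by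
    rw [hx]; exact hf.hasFDerivAt
  exact h.comp (x.2 i) (hasFDerivAt_update_q x i (x.2 i))

lemma dT_eq {f : ℝ × (Fin N → Evec n) → F} (hf : Differentiable ℝ f) :
    dT f = fun x => fderiv ℝ f x ((1, 0) + shiftQ n N x) := by
  funext x
  rw [dT, map_add, shiftQ, sum_apply, map_sum]
  congr 1
  · have h : HasDerivAt (fun s : ℝ => (s, x.2)) ((1, 0) : ℝ × (Fin N → Evec n)) x.1 :=
      (hasDerivAt_id x.1).prodMk (hasDerivAt_const x.1 x.2)
    exact ((hf x).hasFDerivAt.comp_hasDerivAt x.1 h).deriv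
  · refine Finset.sum_congr rfl fun i _ => ?_
    split_ifs with h
    · rw [(hasFDerivAt_comp_update_q x (hf x) i).fderiv]
      rfl
    · simp

lemma ContDiff.dT {f : ℝ × (Fin N → Evec n) → F} (hf : ContDiff ℝ ∞ f) :
    ContDiff ℝ ∞ (dT f) := by
  rw [dT_eq (hf.differentiable (by simp))]
  exact (hf.fderiv_right (m := ∞) (by simp)).clm_apply
    (contDiff_const.add (shiftQ n N).contDiff)

lemma ContDiff.dT_iterate {f : ℝ × (Fin N → Evec n) → F} (hf : ContDiff ℝ ∞ f) (i : ℕ) :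
    ContDiff ℝ ∞ (_root_.dT^[i] f) := by
  induction i with
  | zero => exact hf
  | succ i ih => rw [Function.iterate_succ_apply']; exact ih.dT

lemma IndepFrom.fderiv_fderiv {m : ℕ} {f : ℝ × (Fin N → Evec n) → F} (hf : ContDiff ℝ ∞ f)
    (h : IndepFrom m f) : IndepFrom m (fderiv ℝ f) := by
  intro x j hj u
  have hd : Differentiable ℝ (fderiv ℝ f) :=
    (hf.fderiv_right (m := ∞) (by simp)).differentiable (by simp)
  have hs : IsSymmSndFDerivAt ℝ f x := hf.contDiffAt.isSymmSndFDerivAt (by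
    rw [minSmoothness_of_isRCLikeNormedField]; exact WithTop.coe_le_coe.2 le_top)
  refine ContinuousLinearMap.ext fun a => ?_
  rw [hs.eq]
  have h0 : HasFDerivAt (𝕜 := ℝ) (fun y => fderiv ℝ f y (inclQ n N j u)) 0 x := by
    simp only [h _ j hj u]
    exact hasFDerivAt_const _ _
  have h1 := (hd x).hasFDerivAt.clm_apply (hasFDerivAt_const (inclQ n N j u) x)
  simpa using congrArg (· a) (h1.unique h0)

lemma fderiv_dT_inclQ {f : ℝ × (Fin N → Evec n) → F} (hf : ContDiff ℝ ∞ f) {m : ℕ}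
    (h : IndepFrom m f) (x : ℝ × (Fin N → Evec n)) (i j : Fin N) (hij : (i : ℕ) + 1 = j)
    (hj : m ≤ (j : ℕ)) (u : Evec n) :
    fderiv ℝ (dT f) x (inclQ n N j u) = fderiv ℝ f x (inclQ n N i u) := by
  have hd : Differentiable ℝ (fderiv ℝ f) :=
    (hf.fderiv_right (m := ∞) (by simp)).differentiable (by simp)
  rw [dT_eq (hf.differentiable (by simp)),
    ((hd x).hasFDerivAt.clm_apply ((shiftQ n N).hasFDerivAt.const_add (1, 0))).fderiv]
  simp [h.fderiv_fderiv hf x j hj u, shiftQ_inclQ i j hij]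

lemma IndepFrom.dT {f : ℝ × (Fin N → Evec n) → F} (hf : ContDiff ℝ ∞ f) {m : ℕ}
    (h : IndepFrom m f) : IndepFrom (m + 1) (dT f) := by
  intro x j hj u
  have hjN := j.isLt
  rw [fderiv_dT_inclQ hf h x ⟨(j : ℕ) - 1, by omega⟩ j (by simp; omega) (by omega)]
  exact h x _ (by simp; omega) u

lemma IndepFrom.dT_iterate {f : ℝ × (Fin N → Evec n) → F} (hf : ContDiff ℝ ∞ f) {m : ℕ}
    (h : IndepFrom m f) (i : ℕ) : IndepFrom (m + i) (_root_.dT^[i] f) := by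
  induction i with
  | zero => exact h
  | succ i ih =>
    rw [Function.iterate_succ_apply']
    exact ih.dT (hf.dT_iterate i)

lemma fderiv_dT_iterate_inclQ {f : ℝ × (Fin N → Evec n) → F} (hf : ContDiff ℝ ∞ f) {m : ℕ}
    (h : IndepFrom (m + 1) f) (x : ℝ × (Fin N → Evec n)) (i : ℕ) (a b : Fin N)
    (ha : (a : ℕ) = m) (hb : (b : ℕ) = m + i) (u : Evec n) :
    fderiv ℝ (dT^[i] f) x (inclQ n N b u) = fderiv ℝ f x (inclQ n N a u) := by
  induction i generalizing b with
  | zero =>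
    obtain rfl : b = a := Fin.ext (by omega)
    rfl
  | succ i ih =>
    have hbN := b.isLt
    rw [Function.iterate_succ_apply', fderiv_dT_inclQ (hf.dT_iterate i) (h.dT_iterate hf i) x
      ⟨m + i, by omega⟩ b (by simp; omega) (by omega)]
    exact ih ⟨m + i, by omega⟩ rfl

lemma pgradN_eq {f : ℝ × (Fin N → Evec n) → ℝ} (hf : Differentiable ℝ f) (i : Fin N) :
    pgradN f i = fun x =>
      (InnerProductSpace.toDual ℝ (Evec n)).symm ((fderiv ℝ f x).comp (inclQ n N i)) := by
  funext x
  rw [pgradN, gradient, (hasFDerivAt_comp_update_q x (hf x) i).fderiv]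

lemma ContDiff.pgradN {f : ℝ × (Fin N → Evec n) → ℝ} (hf : ContDiff ℝ ∞ f) (i : Fin N) :
    ContDiff ℝ ∞ (pgradN f i) := by
  rw [pgradN_eq (hf.differentiable (by simp))]
  exact (InnerProductSpace.toDual ℝ (Evec n)).symm.contDiff.comp
    ((hf.fderiv_right (m := ∞) (by simp)).clm_comp contDiff_const)

lemma IndepFrom.pgradN {f : ℝ × (Fin N → Evec n) → ℝ} (hf : ContDiff ℝ ∞ f) {m : ℕ}
    (h : IndepFrom m f) (i : Fin N) : IndepFrom m (pgradN f i) := by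
  intro x j hj u
  have hd : Differentiable ℝ (fderiv ℝ f) :=
    (hf.fderiv_right (m := ∞) (by simp)).differentiable (by simp)
  have h1 := (hd x).hasFDerivAt.clm_comp (hasFDerivAt_const (inclQ n N i) x)
  have h2 := (InnerProductSpace.toDual ℝ (Evec n)).symm.toContinuousLinearEquiv.hasFDerivAt.comp
    x h1
  rw [pgradN_eq (hf.differentiable (by simp))]
  erw [h2.fderiv]
  simp [h.fderiv_fderiv hf x j hj u]

end TotalDerivative

section Momenta

variable {n k N : ℕ}

/-- Truncation of points of `ℝ × (ℝⁿ)^N` to `ℝ × (ℝⁿ)^{k+1}` as a continuous linear map. -/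
def truncCLM (n : ℕ) (h : k + 1 ≤ N) :
    (ℝ × (Fin N → Evec n)) →L[ℝ] ℝ × (Fin (k + 1) → Evec n) :=
  (ContinuousLinearMap.fst ℝ ℝ (Fin N → Evec n)).prod
    (ContinuousLinearMap.pi fun i => (ContinuousLinearMap.proj (R := ℝ)
      (φ := fun _ : Fin N => Evec n) (Fin.castLE h i)).comp
        (ContinuousLinearMap.snd ℝ ℝ (Fin N → Evec n)))

lemma extendL_eq (h : k + 1 ≤ N) (L : ℝ × (Fin (k + 1) → Evec n) → ℝ) :
    extendL h L = fun x => L (truncCLM n h x) := rfl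

lemma truncCLM_inclQ (h : k + 1 ≤ N) (j : Fin N) (hj : k + 1 ≤ (j : ℕ)) (u : Evec n) :
    truncCLM n h (inclQ n N j u) = 0 := by
  ext i : 2
  · rfl
  · have hne : Fin.castLE h i ≠ j := by
      intro e
      have := congrArg Fin.val e
      have := i.isLt
      simp at *
      omega
    simp [truncCLM, inclQ_apply, hne]

lemma contDiff_extendL (h : k + 1 ≤ N) {L : ℝ × (Fin (k + 1) → Evec n) → ℝ}
    (hL : ContDiff ℝ ∞ L) : ContDiff ℝ ∞ (extendL h L) := by
  rw [extendL_eq]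
  exact hL.comp (truncCLM n h).contDiff

lemma indepFrom_extendL (h : k + 1 ≤ N) {L : ℝ × (Fin (k + 1) → Evec n) → ℝ}
    (hL : ContDiff ℝ ∞ L) : IndepFrom (k + 1) (extendL h L) := by
  intro x j hj u
  have hd := ((hL.differentiable (by simp)) (truncCLM n h x)).hasFDerivAt.comp x
    (truncCLM n h).hasFDerivAt
  rw [extendL_eq]
  erw [hd.fderiv]
  simp [truncCLM_inclQ h j hj]

lemma contDiff_hatP (h : k + 1 ≤ N) {L : ℝ × (Fin (k + 1) → Evec n) → ℝ}
    (hL : ContDiff ℝ ∞ L) (r : ℕ) (hr1 : 1 ≤ r) (hrk : r ≤ k) :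
    ContDiff ℝ ∞ (hatP h L r hr1 hrk) := by
  unfold hatP
  exact ContDiff.sum fun i _ =>
    (((contDiff_extendL h hL).pgradN _).dT_iterate _).const_smul _

lemma fderiv_hatP (h : k + 1 ≤ N) {L : ℝ × (Fin (k + 1) → Evec n) → ℝ}
    (hL : ContDiff ℝ ∞ L) (r : ℕ) (hr1 : 1 ≤ r) (hrk : r ≤ k) (x z : ℝ × (Fin N → Evec n)) :
    fderiv ℝ (hatP h L r hr1 hrk) x z = ∑ i : Fin (k - r + 1), ((-1 : ℝ) ^ (i : ℕ)) •
      fderiv ℝ (dT^[(i : ℕ)] (pgradN (extendL h L)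
        ⟨r + (i : ℕ), by have := i.isLt; omega⟩)) x z := by
  have hd := HasFDerivAt.fun_sum (u := Finset.univ) (x := x)
    fun (i : Fin (k - r + 1)) _ =>
    (((((contDiff_extendL h hL).pgradN ⟨r + (i : ℕ), by have := i.isLt; omega⟩).dT_iterate
      (i : ℕ)).differentiable (by simp)) x).hasFDerivAt.const_smul ((-1 : ℝ) ^ (i : ℕ))
  unfold hatP
  erw [hd.fderiv]
  simp

lemma indepFrom_hatP (h : k + 1 ≤ N) {L : ℝ × (Fin (k + 1) → Evec n) → ℝ}
    (hL : ContDiff ℝ ∞ L) (r : ℕ) (hr1 : 1 ≤ r) (hrk : r ≤ k) :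
    IndepFrom (2 * k - r + 1) (hatP h L r hr1 hrk) := by
  intro x j hj u
  rw [fderiv_hatP h hL]
  refine Finset.sum_eq_zero fun i _ => ?_
  have hi := i.isLt
  rw [((indepFrom_extendL h hL).pgradN (contDiff_extendL h hL) _).dT_iterate
    ((contDiff_extendL h hL).pgradN _) i x j (by omega) u, smul_zero]

lemma fderiv_hatP_inclQ (h : k + 1 ≤ N) {L : ℝ × (Fin (k + 1) → Evec n) → ℝ}
    (hL : ContDiff ℝ ∞ L) (r : ℕ) (hr1 : 1 ≤ r) (hrk : r ≤ k) (x : ℝ × (Fin N → Evec n))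
    (j : Fin N) (hj : (j : ℕ) + r = 2 * k) (u : Evec n) :
    fderiv ℝ (hatP h L r hr1 hrk) x (inclQ n N j u) = ((-1 : ℝ) ^ (k - r)) •
      fderiv ℝ (pgradN (extendL h L) ⟨k, h⟩) x (inclQ n N ⟨k, h⟩ u) := by
  have hE := contDiff_extendL h hL
  have hI := indepFrom_extendL h hL
  rw [fderiv_hatP h hL, Finset.sum_eq_single (Fin.last (k - r))]
  · have hk' : (⟨r + (Fin.last (k - r) : ℕ), by simp; omega⟩ : Fin N) = ⟨k, h⟩ :=
      Fin.ext (by simp; omega)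
    rw [fderiv_dT_iterate_inclQ (hE.pgradN _) (hI.pgradN hE _) x _ ⟨k, h⟩ j rfl
      (by simp; omega), hk', Fin.val_last]
  · intro i _ hi
    have hlt := i.isLt
    have hne : (i : ℕ) ≠ k - r := fun e => hi (Fin.ext e)
    rw [(hI.pgradN hE _).dT_iterate (hE.pgradN _) i x j (by omega) u, smul_zero]
  · simp

lemma fderiv_pgradN_extendL (h : k + 1 ≤ N) {L : ℝ × (Fin (k + 1) → Evec n) → ℝ}
    (hL : ContDiff ℝ ∞ L) (x : ℝ × (Fin N → Evec n)) (u : Evec n) :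
    fderiv ℝ (pgradN (extendL h L) ⟨k, h⟩) x (inclQ n N ⟨k, h⟩ u) =
      WithLp.toLp 2 ((hessQk L (truncCLM n h x)).mulVec u) := by
  have hP := (contDiff_extendL h hL).pgradN ⟨k, h⟩
  have hu := hasFDerivAt_comp_update_q x (hP.differentiable (by simp) x) ⟨k, h⟩
  have htr : ∀ v, truncCLM n h (x.1, Function.update x.2 ⟨k, h⟩ v) =
      ((truncCLM n h x).1, Function.update (truncCLM n h x).2 (Fin.last k) v) := by
    intro v
    ext i : 2
    · rfl
    · by_cases hi : i = Fin.last k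
      · subst hi
        simp only [Function.update_self]
        exact Function.update_self (⟨k, h⟩ : Fin N) v x.2
      · have hne : Fin.castLE h i ≠ ⟨k, h⟩ := by
          intro e
          exact hi (Fin.ext (Fin.mk.inj e))
        simp only [Function.update_of_ne hi]
        exact Function.update_of_ne hne v x.2
  have hgrad : ∀ v, pgradN (extendL h L) ⟨k, h⟩ (x.1, Function.update x.2 ⟨k, h⟩ v) =
      gradient (fun w => L ((truncCLM n h x).1,
        Function.update (truncCLM n h x).2 (Fin.last k) w)) v := by
    intro v
    simp only [pgradN, extendL_eq, Function.update_idem, Function.update_self, htr]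
  have hW : ∀ A B, hessQk L (truncCLM n h x) A B =
      fderiv ℝ (pgradN (extendL h L) ⟨k, h⟩) x
        (inclQ n N ⟨k, h⟩ (EuclideanSpace.single B 1)) A := by
    intro A B
    have hA := (EuclideanSpace.proj (𝕜 := ℝ) A : Evec n →L[ℝ] ℝ).hasFDerivAt.comp
      (x.2 ⟨k, h⟩) hu
    have hA' := hA.fderiv
    simp only [Function.comp_def, hgrad] at hA'
    exact congrArg (· (EuclideanSpace.single B 1)) hA'
  ext A
  have hsum : u = ∑ B, u B • EuclideanSpace.single B (1 : ℝ) := by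
    have := (EuclideanSpace.basisFun (Fin n) ℝ).sum_repr u
    simpa using this.symm
  conv_lhs => rw [hsum]
  simp only [map_sum, map_smul, Matrix.mulVec, dotProduct, hW]
  simp [mul_comm]

end Momenta

section LocalDiffeomorph

open Manifold

variable {E : Type*} [NormedAddCommGroup E] [NormedSpace ℝ E] [FiniteDimensional ℝ E]

lemma isLocalDiffeomorphAt_iff_injective_fderiv {f : E → E} (hf : ContDiff ℝ ∞ f) (x : E) :
    IsLocalDiffeomorphAt 𝓘(ℝ, E) 𝓘(ℝ, E) ∞ f x ↔ Function.Injective (fderiv ℝ f x) := by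
  have : CompleteSpace E := FiniteDimensional.complete ℝ E
  have hfd : Differentiable ℝ f := hf.differentiable (by simp)
  constructor
  · intro h
    have hc := h.mfderivToContinuousLinearEquiv_coe (by simp)
    rw [mfderiv_eq_fderiv] at hc
    have := (h.mfderivToContinuousLinearEquiv (by simp)).injective
    intro a b hab
    apply this
    have e := fun c => congrArg (· c) hc
    exact (e a).trans (hab.trans (e b).symm)
  · intro hinj
    have hequiv : ∃ A : E ≃L[ℝ] E, (A : E →L[ℝ] E) = fderiv ℝ f x :=
      ⟨(LinearEquiv.ofInjectiveEndo (fderiv ℝ f x : E →ₗ[ℝ] E) hinj).toContinuousLinearEquiv,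
        by ext; rfl⟩
    obtain ⟨A, hA⟩ := hequiv
    have hfA : HasFDerivAt f (A : E →L[ℝ] E) x := hA ▸ (hfd x).hasFDerivAt
    let φ := hf.contDiffAt.toOpenPartialHomeomorph f hfA (by simp)
    let s : Set E := {y | fderiv ℝ f y ∈ Set.range ((↑) : (E ≃L[ℝ] E) → E →L[ℝ] E)}
    have hs : IsOpen s :=
      ContinuousLinearEquiv.isOpen.preimage (hf.continuous_fderiv (by simp))
    let ψ := φ.restrOpen s hs
    have hψs : ψ.source = φ.source ∩ s := φ.restrOpen_source s hs
    refine ⟨⟨ψ.toPartialEquiv, ψ.open_source, ψ.open_target, ?_, ?_⟩, ?_, ?_⟩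
    · exact hf.contMDiff.contMDiffOn
    · rw [contMDiffOn_iff_contDiffOn]
      intro y hy
      have hys : ψ.symm y ∈ s := (hψs ▸ ψ.map_target hy).2
      obtain ⟨B, hB⟩ := hys
      exact (ψ.contDiffAt_symm hy (f₀' := B) (hB ▸ (hfd _).hasFDerivAt)
        hf.contDiffAt).contDiffWithinAt
    · change x ∈ ψ.source
      rw [hψs]
      exact ⟨hf.contDiffAt.mem_toOpenPartialHomeomorph_source hfA (by simp), A, hA⟩
    · intro y _
      rfl

end LocalDiffeomorph

section Legendre

variable {n k : ℕ}

lemma contDiff_legendreFL (hk : 1 ≤ k) {L : ℝ × (Fin (k + 1) → Evec n) → ℝ}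
    (hL : ContDiff ℝ ∞ L) : ContDiff ℝ ∞ (legendreFL hk L) := by
  refine contDiff_fst.prodMk (contDiff_pi.2 fun j => ?_)
  split_ifs with h
  · exact (contDiff_apply ℝ (Evec n) _).comp contDiff_snd
  · exact contDiff_hatP _ hL _ _ _

lemma fderiv_legendreFL_fst (hk : 1 ≤ k) {L : ℝ × (Fin (k + 1) → Evec n) → ℝ}
    (hL : ContDiff ℝ ∞ L) (w z : ℝ × (Fin (2 * k) → Evec n)) :
    (fderiv ℝ (legendreFL hk L) w z).1 = z.1 := by
  have hd := ((contDiff_legendreFL hk hL).differentiable (by simp) w).hasFDerivAt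
  exact congrArg (· z) (hd.fst.unique hasFDerivAt_fst)

lemma fderiv_legendreFL_snd (hk : 1 ≤ k) {L : ℝ × (Fin (k + 1) → Evec n) → ℝ}
    (hL : ContDiff ℝ ∞ L) (w z : ℝ × (Fin (2 * k) → Evec n)) (j : Fin (2 * k)) :
    (fderiv ℝ (legendreFL hk L) w z).2 j =
      fderiv ℝ (fun x => (legendreFL hk L x).2 j) w z := by
  have hd := ((contDiff_legendreFL hk hL).differentiable (by simp) w).hasFDerivAt
  exact congrArg (· z) (hasFDerivAt_pi'.1 hd.snd j).fderiv.symm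

lemma fderiv_legendreFL_of_lt (hk : 1 ≤ k) {L : ℝ × (Fin (k + 1) → Evec n) → ℝ}
    (hL : ContDiff ℝ ∞ L) (w z : ℝ × (Fin (2 * k) → Evec n)) (j : Fin (2 * k))
    (hj : (j : ℕ) < k) : (fderiv ℝ (legendreFL hk L) w z).2 j = z.2 j := by
  rw [fderiv_legendreFL_snd hk hL]
  simp only [legendreFL, hj, dif_pos]
  exact congrArg (· z) ((hasFDerivAt_apply (𝕜 := ℝ) j w.2).comp w
    (hasFDerivAt_snd (𝕜 := ℝ) (p := w))).fderiv

lemma fderiv_legendreFL_of_le (hk : 1 ≤ k) {L : ℝ × (Fin (k + 1) → Evec n) → ℝ}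
    (hL : ContDiff ℝ ∞ L) (w z : ℝ × (Fin (2 * k) → Evec n)) (j : Fin (2 * k))
    (hj : k ≤ (j : ℕ)) : (fderiv ℝ (legendreFL hk L) w z).2 j =
      fderiv ℝ (hatP (N := 2 * k) (by omega) L ((j : ℕ) - k + 1) (by omega)
        (by have := j.isLt; omega)) w z := by
  rw [fderiv_legendreFL_snd hk hL]
  simp only [legendreFL, hj.not_gt, dif_neg, not_false_eq_true]

lemma injective_fderiv_legendreFL_iff (hk : 1 ≤ k) {L : ℝ × (Fin (k + 1) → Evec n) → ℝ}
    (hL : ContDiff ℝ ∞ L) (w : ℝ × (Fin (2 * k) → Evec n)) :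
    Function.Injective (fderiv ℝ (legendreFL hk L) w) ↔ IsUnit (hessQk L (truncK hk w)) := by
  have hkN : k + 1 ≤ 2 * k := by omega
  have htr : truncK hk w = truncCLM n hkN w := rfl
  rw [← Matrix.mulVec_injective_iff_isUnit, htr]
  set W := hessQk L (truncCLM n hkN w) with hW
  constructor
  · intro hinj
    rw [← Matrix.coe_mulVecLin, injective_iff_map_eq_zero]
    intro u hu
    rw [Matrix.mulVecLin_apply] at hu
    have hz : inclQ n (2 * k) ⟨2 * k - 1, by omega⟩ (WithLp.toLp 2 u) = 0 := by
      refine (injective_iff_map_eq_zero _).1 hinj _ ?_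
      ext j : 2
      · rw [fderiv_legendreFL_fst hk hL]
        rfl
      · rcases lt_or_ge (j : ℕ) k with hj | hj
        · rw [fderiv_legendreFL_of_lt hk hL w _ j hj, inclQ_apply]
          refine Pi.single_eq_of_ne (fun e => ?_) _
          have := congrArg Fin.val e
          simp at this
          omega
        · rw [fderiv_legendreFL_of_le hk hL w _ j hj]
          rcases hj.eq_or_lt with hj | hj
          · rw [fderiv_hatP_inclQ hkN hL _ _ _ w _ (by simp; omega),
              fderiv_pgradN_extendL hkN hL, ← hW]
            simp [hu]
          · exact indepFrom_hatP hkN hL _ _ _ w _ (by simp; omega) _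
    have hz' := congrFun (congrArg Prod.snd hz) ⟨2 * k - 1, by omega⟩
    rw [inclQ_apply] at hz'
    simpa using hz'
  · intro hinj
    rw [injective_iff_map_eq_zero]
    intro z hz
    have ht : z.1 = 0 := by
      rw [← fderiv_legendreFL_fst hk hL w z, hz]
      rfl
    have hq : ∀ m, ∀ j : Fin (2 * k), (j : ℕ) = m → z.2 j = 0 := by
      intro m
      induction m using Nat.strong_induction_on with
      | _ m ih =>
        intro j hjm
        have hjlt := j.isLt
        rcases lt_or_ge (j : ℕ) k with hj | hj
        · rw [← fderiv_legendreFL_of_lt hk hL w z j hj, hz]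
          rfl
        · let r : Fin (2 * k) := ⟨3 * k - 1 - j, by omega⟩
          have hr : fderiv ℝ (hatP hkN L ((r : ℕ) - k + 1) (by omega)
              (by have := r.isLt; omega)) w z = 0 := by
            rw [← fderiv_legendreFL_of_le hk hL w z r (by simp [r]; omega), hz]
            rfl
          rw [eq_time_add_sum_inclQ z, map_add, ht, map_sum, Finset.sum_eq_single j] at hr
          · rw [fderiv_hatP_inclQ hkN hL _ _ _ w _ (by simp [r]; omega),
              fderiv_pgradN_extendL hkN hL, ← hW] at hr
            have h0 : W.mulVec (z.2 j) = 0 := by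
              have hr' : WithLp.toLp 2 (W.mulVec (z.2 j)) = 0 := by
                simpa [Prod.mk_zero_zero] using hr
              simpa using hr'
            have := hinj (h0.trans (Matrix.mulVec_zero W).symm)
            ext A
            exact congrFun this A
          · intro i _ hij
            rcases lt_or_gt_of_ne (fun e => hij (Fin.ext e) : (i : ℕ) ≠ j) with hlt | hgt
            · rw [ih i (by omega) i rfl]
              simp
            · exact indepFrom_hatP hkN hL _ _ _ w i (by simp [r]; omega) _
          · simp
    exact Prod.ext ht (funext fun j => hq j j rfl)

lemma truncK_surjective (hk : 1 ≤ k) : Function.Surjective (truncK (n := n) hk) := by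
  intro p
  refine ⟨(p.1, fun j => if h : (j : ℕ) < k + 1 then p.2 ⟨j, h⟩ else 0), ?_⟩
  refine Prod.ext rfl (funext fun i => ?_)
  exact dif_pos i.isLt

end Legendre

open Manifold in
/-- The restricted Legendre–Ostrogradsky map `FL` is a local diffeomorphism
at a point `w` iff the Hessian `W` of `L` in `q_k` is invertible at (the truncation of) `w`;
consequently `FL` is a local diffeomorphism at every point iff `L` is regular,
i.e. `det W ≠ 0` everywhere. -/
theorem stmt4 (n k : ℕ) (hn : 1 ≤ n) (hk : 1 ≤ k)
    (L : ℝ × (Fin (k+1) → Evec n) → ℝ) (hL : ContDiff ℝ ∞ L) :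
    (∀ w : ℝ × (Fin (2*k) → Evec n),
      IsLocalDiffeomorphAt (𝓘(ℝ, ℝ × (Fin (2*k) → Evec n))) (𝓘(ℝ, ℝ × (Fin (2*k) → Evec n)))
          (⊤ : ℕ∞) (legendreFL hk L) w
        ↔ IsUnit (hessQk L (truncK hk w))) ∧
    ((∀ w : ℝ × (Fin (2*k) → Evec n),
      IsLocalDiffeomorphAt (𝓘(ℝ, ℝ × (Fin (2*k) → Evec n))) (𝓘(ℝ, ℝ × (Fin (2*k) → Evec n)))
          (⊤ : ℕ∞) (legendreFL hk L) w)
        ↔ (∀ p : ℝ × (Fin (k+1) → Evec n), (hessQk L p).det ≠ 0)) := by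
  have hpt := fun w => (isLocalDiffeomorphAt_iff_injective_fderiv
    (contDiff_legendreFL hk hL) w).trans (injective_fderiv_legendreFL_iff hk hL w)
  refine ⟨hpt, ?_⟩
  simp only [← isUnit_iff_ne_zero, ← Matrix.isUnit_iff_isUnit_det]
  rw [(truncK_surjective (n := n) hk).forall]
  exact forall_congr' hpt
end
end

section
/- Assume L is regular, i.e. the Hessian W(t, q_0, …, q_k) is invertible at every point. Then for every initial datum (t_0, x_0, x_1, …, x_{2k−1}) ∈ ℝ × (ℝⁿ)^{2k} there exist ε > 0 and a smooth curve φ : (t_0 − ε, t_0 + ε) → ℝⁿ satisfying the k-th order Euler–Lagrange equation Σ_{i=0}^{k} (−1)^i (dⁱ/dtⁱ)[(∂L/∂q_i) ∘ j^kφ](t) = 0 on this interval, with prescribed initial conditions φ^{(i)}(t_0) = x_i for 0 ≤ i ≤ 2k−1; moreover any two such solutions coincide on a neighbourhood of t_0. -/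
open scoped ContDiff RealInnerProductSpace

noncomputable section

/-- The jet prolongation `t ↦ (t, φ(t), φ'(t), …, φ^{(N-1)}(t))` of a curve `φ : ℝ → ℝⁿ`. -/
noncomputable def jetN {n : ℕ} (N : ℕ) (φ : ℝ → Evec n) (t : ℝ) :
    ℝ × (Fin N → Evec n) := (t, fun i => iteratedDeriv (i : ℕ) φ t)

section

variable {n : ℕ} {V : Type*} [NormedAddCommGroup V] [NormedSpace ℝ V]

lemma hasDerivAt_iteratedDeriv {φ : ℝ → V} (hφ : ContDiff ℝ ∞ φ) (i : ℕ) (t : ℝ) :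
    HasDerivAt (iteratedDeriv i φ) (iteratedDeriv (i + 1) φ t) t := by
  rw [iteratedDeriv_succ]
  exact ((hφ.differentiable_iteratedDeriv i (mod_cast WithTop.coe_lt_top _)) t).hasDerivAt

lemma hasDerivAt_jetN {N : ℕ} {φ : ℝ → Evec n} (hφ : ContDiff ℝ ∞ φ) (t : ℝ) :
    HasDerivAt (jetN N φ) (1, fun i => iteratedDeriv (i + 1) φ t) t :=
  (hasDerivAt_id t).prodMk (hasDerivAt_pi.2 fun i => hasDerivAt_iteratedDeriv hφ i t)

/-- A differential expression `g` in a curve that is given by a smooth function of the jet with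
`N` entries. -/
def IsJetFun (N : ℕ) (g : (ℝ → Evec n) → ℝ → V) : Prop :=
  ∃ G : ℝ × (Fin N → Evec n) → V, ContDiff ℝ ∞ G ∧
    ∀ φ, ContDiff ℝ ∞ φ → ∀ t, g φ t = G (jetN N φ t)

namespace IsJetFun

lemma congr {N : ℕ} {g h : (ℝ → Evec n) → ℝ → V} (hg : IsJetFun N g)
    (hgh : ∀ φ, ContDiff ℝ ∞ φ → ∀ t, h φ t = g φ t) : IsJetFun N h := by
  obtain ⟨G, hG, hG'⟩ := hg
  exact ⟨G, hG, fun φ hφ t => (hgh φ hφ t).trans (hG' φ hφ t)⟩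

lemma mono {N M : ℕ} (h : N ≤ M) {g : (ℝ → Evec n) → ℝ → V} (hg : IsJetFun N g) :
    IsJetFun M g := by
  obtain ⟨G, hG, hG'⟩ := hg
  refine ⟨fun y => G (y.1, fun i => y.2 (Fin.castLE h i)), by fun_prop, fun φ hφ t => ?_⟩
  rw [hG' φ hφ t]
  rfl

lemma comp_jetN {N : ℕ} {F : ℝ × (Fin N → Evec n) → V} (hF : ContDiff ℝ ∞ F) :
    IsJetFun N (fun φ t => F (jetN N φ t)) :=
  ⟨F, hF, fun _ _ _ => rfl⟩

lemma iteratedDeriv_curve {N i : ℕ} (h : i < N) :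
    IsJetFun (n := n) N (fun φ t => iteratedDeriv i φ t) :=
  ⟨fun y => y.2 ⟨i, h⟩, by fun_prop, fun _ _ _ => rfl⟩

lemma add {N : ℕ} {g h : (ℝ → Evec n) → ℝ → V} (hg : IsJetFun N g) (hh : IsJetFun N h) :
    IsJetFun N (fun φ t => g φ t + h φ t) := by
  obtain ⟨G, hG, hG'⟩ := hg
  obtain ⟨H, hH, hH'⟩ := hh
  exact ⟨fun y => G y + H y, hG.add hH, fun φ hφ t => by simp only [hG' φ hφ t, hH' φ hφ t]⟩

lemma const_smul {N : ℕ} (c : ℝ) {g : (ℝ → Evec n) → ℝ → V} (hg : IsJetFun N g) :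
    IsJetFun N (fun φ t => c • g φ t) := by
  obtain ⟨G, hG, hG'⟩ := hg
  exact ⟨fun y => c • G y, hG.const_smul c, fun φ hφ t => by simp only [hG' φ hφ t]⟩

lemma sum {N : ℕ} {ι : Type*} (s : Finset ι) {g : ι → (ℝ → Evec n) → ℝ → V}
    (hg : ∀ i, IsJetFun N (g i)) : IsJetFun N (fun φ t => ∑ i ∈ s, g i φ t) := by
  choose G hG hG' using hg
  exact ⟨fun y => ∑ i ∈ s, G i y, ContDiff.sum fun i _ => hG i,
    fun φ hφ t => Finset.sum_congr rfl fun i _ => hG' i φ hφ t⟩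

lemma clm_apply {N : ℕ} {U : Type*} [NormedAddCommGroup U] [NormedSpace ℝ U]
    {A : (ℝ → Evec n) → ℝ → U →L[ℝ] V} {u : (ℝ → Evec n) → ℝ → U}
    (hA : IsJetFun N A) (hu : IsJetFun N u) : IsJetFun N (fun φ t => A φ t (u φ t)) := by
  obtain ⟨G, hG, hG'⟩ := hA
  obtain ⟨H, hH, hH'⟩ := hu
  exact ⟨fun y => G y (H y), hG.clm_apply hH, fun φ hφ t => by simp only [hG' φ hφ t, hH' φ hφ t]⟩

lemma differentiable {N : ℕ} {g : (ℝ → Evec n) → ℝ → V} (hg : IsJetFun N g)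
    {φ : ℝ → Evec n} (hφ : ContDiff ℝ ∞ φ) : Differentiable ℝ (g φ) := by
  obtain ⟨G, hG, hG'⟩ := hg
  rw [funext (hG' φ hφ)]
  exact (hG.differentiable (by simp)).comp fun t => (hasDerivAt_jetN hφ t).differentiableAt

lemma deriv {N : ℕ} {g : (ℝ → Evec n) → ℝ → V} (hg : IsJetFun N g) :
    IsJetFun (N + 1) (fun φ => deriv (g φ)) := by
  obtain ⟨G, hG, hG'⟩ := hg
  refine ⟨fun y => fderiv ℝ G (y.1, fun i => y.2 i.castSucc) (1, fun i => y.2 i.succ), ?_,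
    fun φ hφ t => ?_⟩
  · exact ((hG.fderiv_right (m := ∞) (by simp)).comp (by fun_prop)).clm_apply (by fun_prop)
  · dsimp only
    rw [funext (hG' φ hφ)]
    exact ((hG.differentiable (by simp) _).hasFDerivAt.comp_hasDerivAt t
      (hasDerivAt_jetN hφ t)).deriv

lemma iteratedDeriv {N : ℕ} {g : (ℝ → Evec n) → ℝ → V} (hg : IsJetFun N g) (i : ℕ) :
    IsJetFun (N + i) (fun φ => iteratedDeriv i (g φ)) := by
  induction i with
  | zero => simpa using hg
  | succ i ih => simpa only [iteratedDeriv_succ, ← add_assoc] using ih.deriv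

end IsJetFun

/-- The partial differential of `F` in the jet variable `q_i`. -/
def jetPartial {N : ℕ} (F : ℝ × (Fin N → Evec n) → V) (i : Fin N) (y : ℝ × (Fin N → Evec n)) :
    Evec n →L[ℝ] V :=
  (fderiv ℝ F y).comp ((ContinuousLinearMap.inr ℝ ℝ (Fin N → Evec n)).comp
    (ContinuousLinearMap.single ℝ (fun _ : Fin N => Evec n) i))

lemma contDiff_jetPartial {N : ℕ} {F : ℝ × (Fin N → Evec n) → V} (hF : ContDiff ℝ ∞ F)
    (i : Fin N) : ContDiff ℝ ∞ (jetPartial F i) :=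
  (hF.fderiv_right (m := ∞) (by simp)).clm_comp contDiff_const

lemma hasFDerivAt_jetPartial {N : ℕ} {F : ℝ × (Fin N → Evec n) → V} (hF : ContDiff ℝ ∞ F)
    (i : Fin N) (y : ℝ × (Fin N → Evec n)) :
    HasFDerivAt (fun v => F (y.1, Function.update y.2 i v)) (jetPartial F i y) (y.2 i) := by
  have h1 := (hasFDerivAt_const (𝕜 := ℝ) y.1 (y.2 i)).prodMk
    (hasFDerivAt_update (𝕜 := ℝ) y.2 (i := i) (y.2 i))
  have h2 : HasFDerivAt F (fderiv ℝ F y) (y.1, Function.update y.2 i (y.2 i)) := by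
    rw [Function.update_eq_self]
    exact (hF.differentiable (by simp) y).hasFDerivAt
  have h : jetPartial F i y = (fderiv ℝ F y).comp
      ((0 : Evec n →L[ℝ] ℝ).prod (.pi (Pi.single i (.id ℝ (Evec n))))) := by
    rw [jetPartial]
    congr 1
    ext v : 2
    · simp
    · refine funext fun j => ?_
      rcases eq_or_ne j i with rfl | hj
      · simp
      · simp [hj]
  rw [h]
  exact h2.comp (y.2 i) h1

/-- The `i + 1`-st derivative of `F ∘ jet` is affine in the highest derivative of the curve, with
linear part the partial differential of `F` in its last variable. -/
lemma isJetFun_iteratedDeriv_sub_jetPartial {m : ℕ} {F : ℝ × (Fin (m + 1) → Evec n) → V}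
    (hF : ContDiff ℝ ∞ F) (i : ℕ) :
    IsJetFun (m + i + 1) (fun φ t => iteratedDeriv (i + 1) (fun s => F (jetN (m + 1) φ s)) t -
      jetPartial F (Fin.last m) (jetN (m + 1) φ t) (iteratedDeriv (m + i + 1) φ t)) := by
  induction i with
  | zero =>
    refine ⟨fun y => fderiv ℝ F y (1, Fin.snoc (fun i : Fin m => y.2 i.succ) 0), ?_,
      fun φ hφ t => ?_⟩
    · refine (hF.fderiv_right (m := ∞) (by simp)).clm_apply (contDiff_const.prodMk ?_)
      refine contDiff_pi.2 fun i => ?_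
      refine Fin.lastCases ?_ (fun i => ?_) i
      · simpa using contDiff_const
      · simp only [Fin.snoc_castSucc]
        fun_prop
    · dsimp only
      rw [zero_add, iteratedDeriv_one]
      have h := ((hF.differentiable (by simp) _).hasFDerivAt.comp_hasDerivAt t
        (hasDerivAt_jetN (N := m + 1) hφ t)).deriv
      rw [show (fun s => F (jetN (m + 1) φ s)) = F ∘ jetN (m + 1) φ from rfl, h, jetPartial,
        ContinuousLinearMap.comp_apply, ← map_sub]
      congr 1
      refine Prod.ext (by simp) (funext fun i => ?_)
      refine Fin.lastCases ?_ (fun i => ?_) i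
      · simp
      · simp [jetN]
  | succ i ih =>
    have hA : IsJetFun (m + 1) (fun φ t => jetPartial F (Fin.last m) (jetN (m + 1) φ t)) :=
      .comp_jetN (contDiff_jetPartial hF _)
    have h := ih.deriv.add
      ((hA.deriv.mono (M := m + i + 1 + 1) (by omega)).clm_apply
        (IsJetFun.iteratedDeriv_curve (n := n) (i := m + i + 1) (by omega)))
    refine h.congr fun φ hφ t => ?_
    have h1 := (ih.differentiable hφ t).hasDerivAt
    have h2 := ((hA.differentiable hφ t).hasDerivAt).clm_apply
      (hasDerivAt_iteratedDeriv hφ (m + i + 1) t)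
    have h3 := h1.add h2
    rw [iteratedDeriv_succ (n := i + 1)]
    rw [sub_eq_iff_eq_add, add_assoc]
    refine Eq.trans ?_ h3.deriv
    congr 1
    ext s
    simp

end

section

lemma contDiffOn_of_hasDerivAt_comp {E : Type*} [NormedAddCommGroup E] [NormedSpace ℝ E]
    {f : E → E} (hf : ContDiff ℝ ∞ f) {α : ℝ → E} {s : Set ℝ} (hs : IsOpen s)
    (h : ∀ t ∈ s, HasDerivAt α (f (α t)) t) : ContDiffOn ℝ ∞ α s := by
  refine contDiffOn_infty.2 fun m => ?_
  induction m with
  | zero => exact contDiffOn_zero.2 fun t ht => (h t ht).continuousAt.continuousWithinAt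
  | succ m ih =>
    push_cast
    refine (contDiffOn_succ_iff_deriv_of_isOpen hs).2
      ⟨fun t ht => (h t ht).differentiableAt.differentiableWithinAt, by simp, ?_⟩
    exact ((hf.of_le (mod_cast le_top)).comp_contDiffOn ih).congr fun t ht => (h t ht).deriv

/-- The vector field on jet space whose integral curves are the jets of the solutions of
`φ^{(m+1)} = R ∘ jet φ`. -/
def jetVectorField {n m : ℕ} (R : ℝ × (Fin (m + 1) → Evec n) → Evec n)
    (y : ℝ × (Fin (m + 1) → Evec n)) : ℝ × (Fin (m + 1) → Evec n) :=
  (1, Fin.snoc (fun i : Fin m => y.2 i.succ) (R y))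

variable {n m : ℕ} {R : ℝ × (Fin (m + 1) → Evec n) → Evec n}

lemma contDiff_jetVectorField (hR : ContDiff ℝ ∞ R) : ContDiff ℝ ∞ (jetVectorField R) := by
  refine contDiff_const.prodMk (contDiff_pi.2 fun i => ?_)
  refine Fin.lastCases ?_ (fun i => ?_) i
  · simpa using hR
  · simp only [Fin.snoc_castSucc]
    fun_prop

lemma hasDerivAt_jetN_jetVectorField {φ : ℝ → Evec n} (hφ : ContDiff ℝ ∞ φ) {t : ℝ}
    (h : iteratedDeriv (m + 1) φ t = R (jetN (m + 1) φ t)) :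
    HasDerivAt (jetN (m + 1) φ) (jetVectorField R (jetN (m + 1) φ t)) t := by
  convert! hasDerivAt_jetN hφ t using 1
  refine Prod.ext rfl (funext fun i => ?_)
  refine Fin.lastCases ?_ (fun i => ?_) i
  · simp [jetVectorField, h]
  · simp [jetVectorField, jetN]

lemma eventuallyEq_of_iteratedDeriv_eq (hR : ContDiff ℝ ∞ R) {φ ψ : ℝ → Evec n} {t₀ : ℝ}
    (hφ : ContDiff ℝ ∞ φ) (hψ : ContDiff ℝ ∞ ψ)
    (h : ∀ᶠ t in nhds t₀, iteratedDeriv (m + 1) φ t = R (jetN (m + 1) φ t))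
    (h' : ∀ᶠ t in nhds t₀, iteratedDeriv (m + 1) ψ t = R (jetN (m + 1) ψ t))
    (h₀ : jetN (m + 1) φ t₀ = jetN (m + 1) ψ t₀) : φ =ᶠ[nhds t₀] ψ := by
  obtain ⟨K, s, hs, hK⟩ := ((contDiff_jetVectorField hR).of_le
    (mod_cast le_top)).contDiffAt.exists_lipschitzOnWith (x := jetN (m + 1) φ t₀)
  have hs' : s ∈ nhds (jetN (m + 1) ψ t₀) := h₀ ▸ hs
  have key : jetN (m + 1) φ =ᶠ[nhds t₀] jetN (m + 1) ψ := by
    refine ODE_solution_unique_of_eventually (v := fun _ => jetVectorField R) (s := fun _ => s)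
      (Filter.Eventually.of_forall fun _ => hK) ?_ ?_ h₀
    · filter_upwards [h, (hasDerivAt_jetN hφ t₀).continuousAt hs] with t ht hts
      exact ⟨hasDerivAt_jetN_jetVectorField hφ ht, hts⟩
    · filter_upwards [h', (hasDerivAt_jetN hψ t₀).continuousAt hs'] with t ht hts
      exact ⟨hasDerivAt_jetN_jetVectorField hψ ht, hts⟩
  filter_upwards [key] with t ht
  simpa [jetN] using congrFun (congrArg Prod.snd ht) 0

lemma exists_contDiff_eqOn_ball {V : Type*} [NormedAddCommGroup V] [NormedSpace ℝ V]
    {γ : ℝ → V} {t₀ ε : ℝ} (hε : 0 < ε) (hγ : ContDiffOn ℝ ∞ γ (Metric.ball t₀ ε)) :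
    ∃ φ : ℝ → V, ContDiff ℝ ∞ φ ∧ Set.EqOn φ γ (Metric.ball t₀ (ε / 3)) := by
  let f : ContDiffBump t₀ := ⟨ε / 3, ε / 2, by positivity, by linarith⟩
  refine ⟨fun t => f t • γ t, contDiff_iff_contDiffAt.2 fun t => ?_, fun t ht => ?_⟩
  · by_cases ht : t ∈ Metric.ball t₀ ε
    · exact f.contDiff.contDiffAt.smul (hγ.contDiffAt (Metric.isOpen_ball.mem_nhds ht))
    · have hft : t ∉ tsupport f := by
        rw [f.tsupport_eq]
        exact fun h => ht (Metric.closedBall_subset_ball (by simp only [f]; linarith) h)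
      refine (contDiffAt_const (c := (0 : V))).congr_of_eventuallyEq ?_
      filter_upwards [notMem_tsupport_iff_eventuallyEq.1 hft] with u hu
      simp [hu]
  · simp [f.one_of_mem_closedBall (Metric.ball_subset_closedBall ht)]

lemma exists_iteratedDeriv_eq (hR : ContDiff ℝ ∞ R) (t₀ : ℝ) (x : Fin (m + 1) → Evec n) :
    ∃ ε > 0, ∃ φ : ℝ → Evec n, ContDiff ℝ ∞ φ ∧ jetN (m + 1) φ t₀ = (t₀, x) ∧
      ∀ t ∈ Metric.ball t₀ ε, iteratedDeriv (m + 1) φ t = R (jetN (m + 1) φ t) := by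
  obtain ⟨α, hα₀, ε, hε, hα⟩ := ((contDiff_jetVectorField hR).of_le (mod_cast le_top)).contDiffAt
    (x := (t₀, x)).exists_forall_mem_closedBall_exists_eq_forall_mem_Ioo_hasDerivAt₀ t₀
  rw [← Real.ball_eq_Ioo] at hα
  have hsmooth := contDiffOn_of_hasDerivAt_comp (contDiff_jetVectorField hR) Metric.isOpen_ball hα
  have htime : Set.EqOn (fun t => (α t).1) id (Metric.ball t₀ ε) := by
    have hd : ∀ t ∈ Metric.ball t₀ ε, HasDerivAt (fun t => (α t).1) 1 t :=
      fun t ht => (hα t ht).fst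
    refine Metric.isOpen_ball.eqOn_of_deriv_eq (convex_ball t₀ ε).isPreconnected
      (fun t ht => (hd t ht).differentiableAt.differentiableWithinAt) differentiableOn_id
      (fun t ht => ?_) (Metric.mem_ball_self hε) (by simp [hα₀])
    simp [(hd t ht).deriv]
  have hcomp : ∀ i, ∀ t ∈ Metric.ball t₀ ε,
      HasDerivAt (fun t => (α t).2 i) ((jetVectorField R (α t)).2 i) t :=
    fun i t ht => hasDerivAt_pi.1 (hα t ht).snd i
  obtain ⟨φ, hφ, hφα⟩ := exists_contDiff_eqOn_ball hε
    (γ := fun t => (α t).2 0) (by fun_prop)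
  have hsub : Metric.ball t₀ (ε / 3) ⊆ Metric.ball t₀ ε := Metric.ball_subset_ball (by linarith)
  have hderiv : ∀ i : Fin (m + 1), ∀ t ∈ Metric.ball t₀ (ε / 3),
      iteratedDeriv i φ t = (α t).2 i := by
    intro i
    induction i using Fin.induction with
    | zero => exact fun t ht => hφα ht
    | succ i ih =>
      intro t ht
      have h := hcomp i.castSucc t (hsub ht)
      simp only [jetVectorField, Fin.snoc_castSucc] at h
      rw [Fin.val_succ, iteratedDeriv_succ, ← h.deriv]
      exact (Filter.eventuallyEq_of_mem (Metric.isOpen_ball.mem_nhds ht) ih).deriv_eq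
  have hjet : ∀ t ∈ Metric.ball t₀ (ε / 3), jetN (m + 1) φ t = α t := fun t ht =>
    Prod.ext (htime (hsub ht)).symm (funext fun i => hderiv i t ht)
  refine ⟨ε / 3, by positivity, φ, hφ, ?_, fun t ht => ?_⟩
  · rw [hjet t₀ (Metric.mem_ball_self (by positivity)), hα₀]
  · have h := hcomp (Fin.last m) t (hsub ht)
    simp only [jetVectorField, Fin.snoc_last] at h
    rw [hjet t ht, iteratedDeriv_succ, ← h.deriv]
    exact (Filter.eventuallyEq_of_mem (Metric.isOpen_ball.mem_nhds ht)
      (hderiv (Fin.last m))).deriv_eq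

end

lemma contDiff_pgradN {n N : ℕ} {L : ℝ × (Fin N → Evec n) → ℝ} (hL : ContDiff ℝ ∞ L)
    (i : Fin N) : ContDiff ℝ ∞ (pgradN L i) := by
  have h : pgradN L i = fun y => (InnerProductSpace.toDual ℝ (Evec n)).symm (jetPartial L i y) := by
    ext1 y
    rw [pgradN, gradient, (hasFDerivAt_jetPartial hL i y).fderiv]
  rw [h]
  exact (LinearIsometryEquiv.contDiff _).comp (contDiff_jetPartial hL i)

lemma jetPartial_pgradN_apply {n k : ℕ} {L : ℝ × (Fin (k + 1) → Evec n) → ℝ}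
    (hL : ContDiff ℝ ∞ L) (y : ℝ × (Fin (k + 1) → Evec n)) (A B : Fin n) :
    jetPartial (pgradN L (Fin.last k)) (Fin.last k) y (EuclideanSpace.single B 1) A =
      hessQk L y A B := by
  have h := (EuclideanSpace.proj (𝕜 := ℝ) A).hasFDerivAt.comp (y.2 (Fin.last k))
    (hasFDerivAt_jetPartial (contDiff_pgradN hL (Fin.last k)) (Fin.last k) y)
  have h' : (EuclideanSpace.proj (𝕜 := ℝ) A : Evec n → ℝ) ∘
      (fun v => pgradN L (Fin.last k) (y.1, Function.update y.2 (Fin.last k) v)) =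
      fun v => gradient (fun w => L (y.1, Function.update y.2 (Fin.last k) w)) v A := by
    ext v
    simp [pgradN]
  rw [h'] at h
  rw [hessQk, h.fderiv]
  rfl

lemma isUnit_jetPartial_pgradN {n k : ℕ} {L : ℝ × (Fin (k + 1) → Evec n) → ℝ}
    (hL : ContDiff ℝ ∞ L) {y : ℝ × (Fin (k + 1) → Evec n)} (h : IsUnit (hessQk L y)) :
    IsUnit (jetPartial (pgradN L (Fin.last k)) (Fin.last k) y) := by
  have hA : jetPartial (pgradN L (Fin.last k)) (Fin.last k) y =
      Matrix.toEuclideanCLM (𝕜 := ℝ) (hessQk L y) := by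
    refine ContinuousLinearMap.coe_injective
      ((EuclideanSpace.basisFun (Fin n) ℝ).toBasis.ext fun B => ?_)
    ext A
    simp [jetPartial_pgradN_apply hL]
  rw [hA]
  exact h.map Matrix.toEuclideanCLM

/-- The left-hand side of the Euler–Lagrange equation. -/
def eulerLagrange {n k : ℕ} (L : ℝ × (Fin (k + 1) → Evec n) → ℝ) (φ : ℝ → Evec n) (t : ℝ) :
    Evec n :=
  ∑ i : Fin (k + 1), ((-1 : ℝ) ^ (i : ℕ)) •
    iteratedDeriv (i : ℕ) (fun s => pgradN L i (jetN (k + 1) φ s)) t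

/-- The Euler–Lagrange expression of order `m + 1` is affine in the derivative of order
`2 * m + 2`, with linear part the Hessian up to sign. -/
lemma isJetFun_eulerLagrange_sub {n m : ℕ} {L : ℝ × (Fin (m + 1 + 1) → Evec n) → ℝ}
    (hL : ContDiff ℝ ∞ L) :
    IsJetFun (m + 1 + m + 1) (fun φ t => eulerLagrange L φ t - (-1 : ℝ) ^ (m + 1) •
      jetPartial (pgradN L (Fin.last (m + 1))) (Fin.last (m + 1)) (jetN (m + 1 + 1) φ t)
        (iteratedDeriv (m + 1 + m + 1) φ t)) := by
  have h := (isJetFun_iteratedDeriv_sub_jetPartial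
    (contDiff_pgradN hL (Fin.last (m + 1))) m).const_smul ((-1 : ℝ) ^ (m + 1))
  have h' : IsJetFun (m + 1 + m + 1) (fun φ t => ∑ i : Fin (m + 1), ((-1 : ℝ) ^ (i : ℕ)) •
      iteratedDeriv (i : ℕ) (fun s => pgradN L i.castSucc (jetN (m + 1 + 1) φ s)) t) := by
    refine .sum _ fun i => .const_smul _ ?_
    exact ((IsJetFun.comp_jetN (contDiff_pgradN hL i.castSucc)).iteratedDeriv i).mono (by omega)
  refine (h'.add h).congr fun φ hφ t => ?_
  rw [eulerLagrange, Fin.sum_univ_castSucc, smul_sub, ← add_sub_assoc]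
  rfl

/-- For a regular Lagrangian, the Euler–Lagrange equation can be solved smoothly for the highest
derivative. -/
lemma exists_eulerLagrange_eq_zero_iff {n m : ℕ} {L : ℝ × (Fin (m + 1 + 1) → Evec n) → ℝ}
    (hL : ContDiff ℝ ∞ L) (hreg : ∀ y, IsUnit (hessQk L y)) :
    ∃ R : ℝ × (Fin (m + 1 + m + 1) → Evec n) → Evec n, ContDiff ℝ ∞ R ∧
      ∀ φ, ContDiff ℝ ∞ φ → ∀ t, eulerLagrange L φ t = 0 ↔
        iteratedDeriv (m + 1 + m + 1) φ t = R (jetN (m + 1 + m + 1) φ t) := by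
  obtain ⟨G, hG, hG'⟩ := isJetFun_eulerLagrange_sub hL
  set A := jetPartial (pgradN L (Fin.last (m + 1))) (Fin.last (m + 1)) with hA
  have hAs : ContDiff ℝ ∞ A := contDiff_jetPartial (contDiff_pgradN hL _) _
  have hAu : ∀ y, IsUnit (A y) := fun y => isUnit_jetPartial_pgradN hL (hreg y)
  have hinv : ContDiff ℝ ∞ (fun y => Ring.inverse (A y)) := contDiff_iff_contDiffAt.2 fun y => by
    obtain ⟨u, hu⟩ := hAu y
    have h := contDiffAt_ringInverse (n := ∞) ℝ u
    rw [hu] at h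
    exact h.comp y hAs.contDiffAt
  obtain ⟨B, hB, hB'⟩ := (IsJetFun.comp_jetN hinv).mono
    (show m + 1 + 1 ≤ m + 1 + m + 1 by omega)
  refine ⟨fun y => B y (-(-1 : ℝ) ^ (m + 1) • G y), hB.clm_apply (hG.const_smul _),
    fun φ hφ t => ?_⟩
  have hc : (-1 : ℝ) ^ (m + 1) * (-1) ^ (m + 1) = 1 := by
    rw [← mul_pow]
    simp
  have h := hG' φ hφ t
  simp only [← hB' φ hφ t, ← h]
  set a := A (jetN (m + 1 + 1) φ t)
  set v := iteratedDeriv (m + 1 + m + 1) φ t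
  have ha : IsUnit a := hAu _
  have h1 : ∀ w, Ring.inverse a (a w) = w := fun w =>
    DFunLike.congr_fun (Ring.inverse_mul_cancel a ha) w
  rw [smul_sub, neg_smul, neg_smul, smul_smul, hc, one_smul, sub_neg_eq_add, map_add, h1,
    right_eq_add]
  constructor
  · intro h0
    simp [h0]
  · intro h0
    have h2 := congrArg a h0
    rw [← mul_apply_eq_comp, Ring.mul_inverse_cancel a ha] at h2
    simpa using h2

/-- For a regular `k`-th order Lagrangian, the Euler–Lagrange equation has
local solutions with arbitrary prescribed initial data `(t_0, x_0, …, x_{2k-1})`, and any two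
such solutions coincide near `t_0`. -/
theorem stmt8 (n k : ℕ) (hn : 1 ≤ n) (hk : 1 ≤ k)
    (L : ℝ × (Fin (k+1) → Evec n) → ℝ) (hL : ContDiff ℝ ∞ L)
    (hreg : ∀ x : ℝ × (Fin (k+1) → Evec n), IsUnit (hessQk L x))
    (t₀ : ℝ) (x : ℕ → Evec n) :
    (∃ ε > (0:ℝ), ∃ φ : ℝ → Evec n, ContDiff ℝ ∞ φ ∧
      (∀ t ∈ Set.Ioo (t₀ - ε) (t₀ + ε),
        (∑ i : Fin (k+1), ((-1:ℝ)^(i : ℕ)) •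
          iteratedDeriv (i : ℕ) (fun s => pgradN L i (jetN (k+1) φ s)) t) = 0) ∧
      (∀ i ≤ 2*k - 1, iteratedDeriv i φ t₀ = x i)) ∧
    (∀ φ ψ : ℝ → Evec n, ContDiff ℝ ∞ φ → ContDiff ℝ ∞ ψ →
      (∀ᶠ t in nhds t₀,
        (∑ i : Fin (k+1), ((-1:ℝ)^(i : ℕ)) •
          iteratedDeriv (i : ℕ) (fun s => pgradN L i (jetN (k+1) φ s)) t) = 0) →
      (∀ᶠ t in nhds t₀,
        (∑ i : Fin (k+1), ((-1:ℝ)^(i : ℕ)) •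
          iteratedDeriv (i : ℕ) (fun s => pgradN L i (jetN (k+1) ψ s)) t) = 0) →
      (∀ i ≤ 2*k - 1, iteratedDeriv i φ t₀ = x i) →
      (∀ i ≤ 2*k - 1, iteratedDeriv i ψ t₀ = x i) →
      φ =ᶠ[nhds t₀] ψ) := by
  obtain ⟨m, rfl⟩ := Nat.exists_eq_add_of_le' hk
  obtain ⟨R, hR, hRL⟩ := exists_eulerLagrange_eq_zero_iff hL hreg
  refine ⟨?_, fun φ ψ hφ hψ hELφ hELψ hφ₀ hψ₀ => ?_⟩
  · obtain ⟨ε, hε, φ, hφ, hφ₀, hφR⟩ := exists_iteratedDeriv_eq hR t₀ (fun i => x i)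
    refine ⟨ε, hε, φ, hφ, fun t ht => ?_, fun i hi => ?_⟩
    · rw [← Real.ball_eq_Ioo] at ht
      exact (hRL φ hφ t).2 (hφR t ht)
    · exact congrFun (congrArg Prod.snd hφ₀) ⟨i, by omega⟩
  · refine eventuallyEq_of_iteratedDeriv_eq hR hφ hψ
      (hELφ.mono fun t ht => (hRL φ hφ t).1 ht) (hELψ.mono fun t ht => (hRL ψ hψ t).1 ht)
      (Prod.ext rfl (funext fun i => ?_))
    exact (hφ₀ i (by omega)).trans (hψ₀ i (by omega)).symm
end
end
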